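/- Let G be a cactus with n ≥ 5 vertices and t cycles (where 0 ≤ t ≤ (n−1)/2). Then SO(G) ≤ (n − 2t − 1)·√((n−1)² + 1) + 2t·√((n−1)² + 4) + 2√2·t, with equality if and only if G ≅ H(n,t), the graph obtained from the star K_{1,n−1} by adding t independent edges among pendant vertices. -/

import Mathlib

attribute [local instance] Classical.propDecidable

/-- The Sombor index of a finite simple graph:
`SO(G) = Σ_{uv ∈ E(G)} √(d(u)² + d(v)²)`, written as half the sum over ordered adjacent pairs. -/
noncomputable def somborIndex {V : Type*} [Fintype V] (G : SimpleGraph V) : ℝ :=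
  (∑ u : V, ∑ v : V,
      if G.Adj u v then Real.sqrt ((G.degree u : ℝ)^2 + (G.degree v : ℝ)^2) else 0) / 2

/-- A cactus: a connected graph in which any two distinct cycles share at most one vertex. -/
def IsCactus {V : Type*} (G : SimpleGraph V) : Prop :=
  G.Connected ∧ ∀ (u v : V) (c₁ : G.Walk u u) (c₂ : G.Walk v v),
    c₁.IsCycle → c₂.IsCycle → c₁.edges.toFinset ≠ c₂.edges.toFinset →
      (c₁.support.toFinset ∩ c₂.support.toFinset).card ≤ 1

/-- `Hgraph n t` : the cactus obtained from the star `K_{1,n-1}` (center `0`) by joining the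
`t` disjoint pairs of pendant vertices `(2k+1, 2k+2)`, `k < t`, by edges. -/
def Hgraph (n t : ℕ) : SimpleGraph (Fin n) :=
  SimpleGraph.fromRel (fun u v =>
    u.val = 0 ∨ ∃ k, k < t ∧ u.val = 2 * k + 1 ∧ v.val = 2 * k + 2)

/-- `HstarGraph β t` : the cactus on `2β` vertices with a perfect matching: a center `0` of
degree `β + t` adjacent to `1, …, β + t`; `t` triangles through the center formed by the edges
`(2k+1, 2k+2)`, `k < t`; vertex `β + t` is a pendant vertex at the center; and each vertex
`2t + j` (`1 ≤ j ≤ β - t - 1`) carries the pendant vertex `β + t + j`. -/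
def HstarGraph (β t : ℕ) : SimpleGraph (Fin (2 * β)) :=
  SimpleGraph.fromRel (fun u v =>
    (u.val = 0 ∧ 1 ≤ v.val ∧ v.val ≤ β + t) ∨
    (∃ k, k < t ∧ u.val = 2 * k + 1 ∧ v.val = 2 * k + 2) ∨
    (∃ j, 1 ≤ j ∧ j ≤ β - t - 1 ∧ u.val = 2 * t + j ∧ v.val = β + t + j))


open SimpleGraph Finset

section Cycles

variable {V : Type*} {G : SimpleGraph V}

/-- An arc of a cycle between two of its vertices. -/
lemma SimpleGraph.Walk.IsCycle.exists_isPath_of_mem_support {u v w : V} {c : G.Walk u u}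
    (hc : c.IsCycle) (hv : v ∈ c.support) (hw : w ∈ c.support) :
    ∃ p : G.Walk v w, p.IsPath ∧ p.edges ⊆ c.edges ∧ p.support ⊆ c.support := by
  have hw' : w ∈ (c.rotate v hv).support := (c.mem_support_rotate_iff v hv).2 hw
  refine ⟨(c.rotate v hv).takeUntil w hw', (hc.rotate hv).isPath_takeUntil hw', ?_, ?_⟩
  · intro e he
    exact (c.rotate_edges v hv).mem_iff.1 (Walk.edges_takeUntil_subset_edges _ hw' he)
  · intro x hx
    exact (c.mem_support_rotate_iff v hv).1 (Walk.support_takeUntil_subset_support _ hw' hx)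

lemma IsCactus.edges_eq_of_two_common (hG : IsCactus G) {u v x y : V} {c₁ : G.Walk u u}
    {c₂ : G.Walk v v} (h₁ : c₁.IsCycle) (h₂ : c₂.IsCycle) (hxy : x ≠ y)
    (hx₁ : x ∈ c₁.support) (hx₂ : x ∈ c₂.support)
    (hy₁ : y ∈ c₁.support) (hy₂ : y ∈ c₂.support) :
    c₁.edges.toFinset = c₂.edges.toFinset := by
  by_contra hne
  have h := hG.2 u v c₁ c₂ h₁ h₂ hne
  rw [Finset.card_le_one] at h
  exact hxy (h x (by simp [hx₁, hx₂]) y (by simp [hy₁, hy₂]))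

lemma IsCactus.mem_edges_of_adj (hG : IsCactus G) {u v w : V} {c : G.Walk u u}
    (hc : c.IsCycle) (hv : v ∈ c.support) (hw : w ∈ c.support) (hvw : G.Adj v w) :
    s(v, w) ∈ c.edges := by
  by_contra hnot
  obtain ⟨p, hp, hpe, -⟩ := hc.exists_isPath_of_mem_support hv hw
  have hc' : (Walk.cons hvw.symm p).IsCycle := by
    rw [Walk.cons_isCycle_iff]
    exact ⟨hp, fun h => hnot (by rw [Sym2.eq_swap]; exact hpe h)⟩
  have h := hG.edges_eq_of_two_common hc hc' hvw.ne hv (by simp) hw (by simp)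
  have hmem : s(w, v) ∈ c.edges.toFinset := by rw [h]; simp
  exact hnot (by rw [Sym2.eq_swap]; exact List.mem_toFinset.1 hmem)

lemma IsCactus.eq_of_adj_of_notMem_support (hG : IsCactus G) {u v w x : V} {c : G.Walk u u}
    (hc : c.IsCycle) (hv : v ∈ c.support) (hw : w ∈ c.support) (hx : x ∉ c.support)
    (hvx : G.Adj v x) (hwx : G.Adj w x) : v = w := by
  by_contra hne
  obtain ⟨p, hp, hpe, hps⟩ := hc.exists_isPath_of_mem_support hv hw
  have hc' : (Walk.cons hvx.symm (p.concat hwx)).IsCycle := by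
    rw [Walk.cons_isCycle_iff]
    refine ⟨hp.concat (fun h => hx (hps h)) hwx, fun h => ?_⟩
    rw [Walk.edges_concat, List.concat_eq_append, List.mem_append] at h
    rcases h with h | h
    · exact hx (c.fst_mem_support_of_mem_edges (hpe h))
    · rw [List.mem_singleton, Sym2.eq_swap, Sym2.congr_left] at h
      exact hne h
  have h := hG.edges_eq_of_two_common hc hc' hne hv (by simp [Walk.support_concat])
    hw (by simp [Walk.support_concat])
  have hmem : s(x, v) ∈ c.edges.toFinset := by rw [h]; simp
  exact hx (c.fst_mem_support_of_mem_edges (List.mem_toFinset.1 hmem))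

lemma SimpleGraph.isCycle_triangle {a b c : V} (hab : G.Adj a b) (hbc : G.Adj b c)
    (hca : G.Adj c a) : (Walk.cons hab (Walk.cons hbc (Walk.cons hca Walk.nil))).IsCycle := by
  rw [Walk.cons_isCycle_iff]
  have := hab.ne
  have := hbc.ne
  have := hca.ne
  constructor
  · simp [Walk.cons_isPath_iff]
    grind
  · simp
    grind

lemma IsCactus.eq_of_adj_of_adj (hG : IsCactus G) {a b x y : V} (hab : G.Adj a b)
    (hax : G.Adj a x) (hbx : G.Adj b x) (hay : G.Adj a y) (hby : G.Adj b y) : x = y := by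
  have hc := SimpleGraph.isCycle_triangle hab hbx hax.symm
  by_contra hne
  refine hab.ne (hG.eq_of_adj_of_notMem_support hc (v := a) (w := b) (x := y) (by simp) (by simp)
    ?_ hay hby)
  simp [hay.ne', hby.ne', Ne.symm hne]

variable [Fintype V]

lemma SimpleGraph.Walk.IsCycle.card_filter_mem_edges {u v : V} {c : G.Walk u u}
    (hc : c.IsCycle) (hv : v ∈ c.support) : #{w | s(v, w) ∈ c.edges} = 2 := by
  have h := hc.ncard_neighborSet_toSubgraph_eq_two hv
  rw [← h, ← Set.ncard_coe_finset]
  congr 1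
  ext w
  simp [Walk.adj_toSubgraph_iff_mem_edges]

lemma SimpleGraph.Walk.IsCycle.three_le_card_support {u : V} {c : G.Walk u u}
    (hc : c.IsCycle) : 3 ≤ #c.support.toFinset := by
  have h : insert u ({w | s(u, w) ∈ c.edges} : Finset V) ⊆ c.support.toFinset := by
    intro w hw
    rw [Finset.mem_insert, Finset.mem_filter] at hw
    rw [List.mem_toFinset]
    rcases hw with rfl | hw
    · simp
    · exact c.snd_mem_support_of_mem_edges hw.2
  have h' := Finset.card_le_card h
  rw [Finset.card_insert_of_notMem, hc.card_filter_mem_edges (by simp)] at h'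
  · exact h'
  · simp only [Finset.mem_filter, not_and]
    intro _ hu
    exact (c.adj_of_mem_edges hu).ne rfl

lemma SimpleGraph.Walk.IsCycle.two_le_degree {u v : V} {c : G.Walk u u}
    (hc : c.IsCycle) (hv : v ∈ c.support) : 2 ≤ G.degree v := by
  rw [← hc.card_filter_mem_edges hv, ← G.card_neighborFinset_eq_degree]
  refine Finset.card_le_card fun w hw => ?_
  rw [Finset.mem_filter] at hw
  rw [mem_neighborFinset]
  exact c.adj_of_mem_edges hw.2

/-- The neighbours of a cycle of a cactus outside the cycle are distinct. -/
lemma IsCactus.sum_degree_sub_two_add_card_le (hG : IsCactus G) {u : V} {c : G.Walk u u}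
    (hc : c.IsCycle) :
    ∑ v ∈ c.support.toFinset, (G.degree v - 2) + #c.support.toFinset ≤ Fintype.card V := by
  have h₁ : ∀ v ∈ c.support.toFinset,
      G.degree v - 2 = #(G.neighborFinset v \ c.support.toFinset) := by
    intro v hv
    rw [List.mem_toFinset] at hv
    rw [← hc.card_filter_mem_edges hv, ← G.card_neighborFinset_eq_degree,
      ← Finset.card_sdiff_add_card_inter (G.neighborFinset v) c.support.toFinset]
    have : G.neighborFinset v ∩ c.support.toFinset =
        ({w | s(v, w) ∈ c.edges} : Finset V) := by
      ext w
      simp only [Finset.mem_inter, mem_neighborFinset, List.mem_toFinset, Finset.mem_filter,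
        Finset.mem_univ, true_and]
      exact ⟨fun h => hG.mem_edges_of_adj hc hv h.2 h.1,
        fun h => ⟨c.adj_of_mem_edges h, c.snd_mem_support_of_mem_edges h⟩⟩
    rw [this]
    omega
  rw [Finset.sum_congr rfl h₁, ← Finset.card_biUnion, ← Finset.card_compl_add_card c.support.toFinset]
  · refine Nat.add_le_add_right (Finset.card_le_card fun w hw => ?_) _
    simp only [Finset.mem_biUnion, Finset.mem_sdiff] at hw
    obtain ⟨-, -, -, hw⟩ := hw
    simpa using hw
  · intro v hv w hw hne
    simp only [SetLike.mem_coe, List.mem_toFinset] at hv hw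
    rw [Function.onFun, Finset.disjoint_left]
    intro x hx hx'
    simp only [Finset.mem_sdiff, mem_neighborFinset, List.mem_toFinset] at hx hx'
    exact hne (hG.eq_of_adj_of_notMem_support hc hv hw hx.2 hx.1 hx'.1)

/-- The edge sets of the cycles of a graph. -/
noncomputable def cycleEdgeSets (G : SimpleGraph V) : Finset (Finset (Sym2 V)) :=
  {s | ∃ (u : V) (c : G.Walk u u), c.IsCycle ∧ c.edges.toFinset = s}

lemma mem_cycleEdgeSets {s : Finset (Sym2 V)} :
    s ∈ cycleEdgeSets G ↔ ∃ (u : V) (c : G.Walk u u), c.IsCycle ∧ c.edges.toFinset = s := by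
  simp [cycleEdgeSets]

lemma IsCactus.eq_of_mem_of_mem (hG : IsCactus G) {s s' : Finset (Sym2 V)}
    (hs : s ∈ cycleEdgeSets G) (hs' : s' ∈ cycleEdgeSets G) {x y : V}
    (h : s(x, y) ∈ s) (h' : s(x, y) ∈ s') : s = s' := by
  obtain ⟨u, c, hc, rfl⟩ := mem_cycleEdgeSets.1 hs
  obtain ⟨u', c', hc', rfl⟩ := mem_cycleEdgeSets.1 hs'
  rw [List.mem_toFinset] at h h'
  exact hG.edges_eq_of_two_common hc hc' (c.adj_of_mem_edges h).ne
    (c.fst_mem_support_of_mem_edges h) (c'.fst_mem_support_of_mem_edges h')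
    (c.snd_mem_support_of_mem_edges h) (c'.snd_mem_support_of_mem_edges h')

/-- The ends of an edge that lies on no cycle have disjoint neighbourhoods. -/
lemma degree_add_degree_le_of_notMem_cycle {x y : V} (hxy : G.Adj x y)
    (h : ∀ s ∈ cycleEdgeSets G, s(x, y) ∉ s) : G.degree x + G.degree y ≤ Fintype.card V := by
  rw [← G.card_neighborFinset_eq_degree, ← G.card_neighborFinset_eq_degree,
    ← Finset.card_union_of_disjoint]
  · exact Finset.card_le_univ _
  · rw [Finset.disjoint_left]
    intro z hx hy
    rw [mem_neighborFinset] at hx hy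
    refine h _ (mem_cycleEdgeSets.2 ⟨x, _, isCycle_triangle hxy hy hx.symm, rfl⟩) ?_
    simp

lemma SimpleGraph.Connected.card_edgeFinset_le_of_isAcyclic {H : SimpleGraph V}
    [Fintype H.edgeSet]     (hG : G.Connected) (hle : H ≤ G) (hH : H.IsAcyclic) :
    #H.edgeFinset + 1 ≤ Fintype.card V := by
  obtain ⟨T, hHT, -, hT⟩ := hG.exists_isTree_le_of_le_of_isAcyclic hle hH
  rw [← hT.card_edgeFinset]
  exact Nat.add_le_add_right (Finset.card_le_card (edgeFinset_subset_edgeFinset.2 hHT)) _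

/-- The cyclomatic number is at most the number of cycles. -/
lemma SimpleGraph.Connected.card_edgeFinset_succ_le (hG : G.Connected) :
    #G.edgeFinset + 1 ≤ Fintype.card V + #(cycleEdgeSets G) := by
  have hne : ∀ s ∈ cycleEdgeSets G, ∃ e, e ∈ s := by
    intro s hs
    obtain ⟨u, c, hc, rfl⟩ := mem_cycleEdgeSets.1 hs
    obtain ⟨e, he⟩ := List.exists_mem_of_ne_nil c.edges
      (by rw [Ne, Walk.edges_eq_nil]; exact hc.not_nil)
    exact ⟨e, List.mem_toFinset.2 he⟩
  have : Nonempty (Sym2 V) := hG.nonempty.map fun v => s(v, v)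
  choose! f hf using hne
  set D := (cycleEdgeSets G).image f
  have hacyc : (G.deleteEdges (D : Set (Sym2 V))).IsAcyclic := by
    intro u c hc
    have hle := G.deleteEdges_le (D : Set (Sym2 V))
    have hs : (c.mapLe hle).edges.toFinset ∈ cycleEdgeSets G :=
      mem_cycleEdgeSets.2 ⟨u, _, hc.mapLe hle, rfl⟩
    have h := hf _ hs
    rw [Walk.edges_mapLe_eq_edges, List.mem_toFinset] at h
    have h' := c.edges_subset_edgeSet h
    rw [edgeSet_deleteEdges] at h'
    refine h'.2 ?_
    have h₀ := Finset.mem_image_of_mem f hs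
    rwa [Walk.edges_mapLe_eq_edges] at h₀
  have h₁ := hG.card_edgeFinset_le_of_isAcyclic (G.deleteEdges_le _) hacyc
  have h₂ : #G.edgeFinset ≤ #(G.deleteEdges (D : Set (Sym2 V))).edgeFinset + #D := by
    rw [← Nat.sub_le_iff_le_add]
    refine (Finset.le_card_sdiff D G.edgeFinset).trans (Finset.card_le_card fun e he => ?_)
    simpa [edgeSet_deleteEdges] using he
  have h₃ : #D ≤ #(cycleEdgeSets G) := Finset.card_image_le
  omega

end Cycles

section Estimates

lemma four_add_two_mul_lt {N : ℝ} (hN : 2 < N) :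
    4 + 2 * N < 2 * √2 * √(N ^ 2 + 4) := by
  rw [mul_assoc, ← Real.sqrt_mul (by norm_num)]
  have : 2 + N < √(2 * (N ^ 2 + 4)) := by
    apply Real.lt_sqrt_of_sq_lt
    nlinarith [mul_pos (sub_pos.2 hN) (sub_pos.2 hN)]
  linarith

lemma two_mul_sqrt_two_lt {N : ℝ} (hN : 2 < N) : 2 * √2 < √(N ^ 2 + 4) := by
  apply Real.lt_sqrt_of_sq_lt
  rw [mul_pow, Real.sq_sqrt (by norm_num)]
  nlinarith

/-- The square of the chord over `[0, N - 2]` of the convex function `z ↦ √((2 + z)² + 4)`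
exceeds the square of the function by a multiple of `z (N - 2 - z)`. -/
lemma sq_chord_eq {N : ℝ} (hN : 2 < N) (z : ℝ) :
    (2 * √2 + z * ((√(N ^ 2 + 4) - 2 * √2) / (N - 2))) ^ 2 =
      (2 + z) ^ 2 + 4 + 2 * (z * (N - 2 - z)) / (N - 2) ^ 2 *
        (2 * √2 * √(N ^ 2 + 4) - (4 + 2 * N)) := by
  have h₁ : √2 ^ 2 = 2 := Real.sq_sqrt (by norm_num)
  have h₂ : √(N ^ 2 + 4) ^ 2 = N ^ 2 + 4 := Real.sq_sqrt (by positivity)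
  have h₃ : N - 2 ≠ 0 := by linarith
  generalize √2 = r at *
  generalize √(N ^ 2 + 4) = K at *
  field_simp
  linear_combination (4 * (N - 2 - z) ^ 2) * h₁ + z ^ 2 * h₂

lemma sqrt_sq_add_sq_le_chord {N a b : ℝ} (hN : 2 < N) (ha : 2 ≤ a) (hb : 2 ≤ b)
    (hab : (a - 2) + (b - 2) ≤ N - 2) :
    √(a ^ 2 + b ^ 2) ≤
      2 * √2 + ((a - 2) + (b - 2)) * ((√(N ^ 2 + 4) - 2 * √2) / (N - 2)) := by
  have h₁ := two_mul_sqrt_two_lt hN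
  have h₂ := four_add_two_mul_lt hN
  apply Real.sqrt_le_iff.2 ⟨?_, ?_⟩
  · have : 0 ≤ ((a - 2) + (b - 2)) * ((√(N ^ 2 + 4) - 2 * √2) / (N - 2)) :=
      mul_nonneg (by linarith) (div_nonneg (by linarith) (by linarith))
    positivity
  · rw [sq_chord_eq hN]
    have : 0 ≤ 2 * (((a - 2) + (b - 2)) * (N - 2 - ((a - 2) + (b - 2)))) / (N - 2) ^ 2 *
        (2 * √2 * √(N ^ 2 + 4) - (4 + 2 * N)) :=
      mul_nonneg (div_nonneg (mul_nonneg (by norm_num) (mul_nonneg (by linarith) (by linarith)))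
        (sq_nonneg _)) (by linarith)
    nlinarith [mul_nonneg (sub_nonneg.2 ha) (sub_nonneg.2 hb)]

lemma sqrt_sq_add_sq_lt_chord {N a b : ℝ} (hN : 2 < N) (ha : 2 < a) (haN : a < N) (hb : 2 ≤ b)
    (hab : (a - 2) + (b - 2) ≤ N - 2) :
    √(a ^ 2 + b ^ 2) <
      2 * √2 + ((a - 2) + (b - 2)) * ((√(N ^ 2 + 4) - 2 * √2) / (N - 2)) := by
  have h₁ := two_mul_sqrt_two_lt hN
  have h₂ := four_add_two_mul_lt hN
  have hpos : 0 < 2 * √2 + ((a - 2) + (b - 2)) * ((√(N ^ 2 + 4) - 2 * √2) / (N - 2)) := by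
    have : 0 ≤ ((a - 2) + (b - 2)) * ((√(N ^ 2 + 4) - 2 * √2) / (N - 2)) :=
      mul_nonneg (by linarith) (div_nonneg (by linarith) (by linarith))
    positivity
  rw [Real.sqrt_lt' hpos, sq_chord_eq hN]
  rcases hb.eq_or_lt with rfl | hb
  · have : 0 < 2 * (((a - 2) + (2 - 2)) * (N - 2 - ((a - 2) + (2 - 2)))) / (N - 2) ^ 2 *
        (2 * √2 * √(N ^ 2 + 4) - (4 + 2 * N)) :=
      mul_pos (div_pos (mul_pos (by norm_num) (mul_pos (by linarith) (by linarith)))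
        (pow_pos (by linarith) 2)) (by linarith)
    nlinarith
  · have : 0 ≤ 2 * (((a - 2) + (b - 2)) * (N - 2 - ((a - 2) + (b - 2)))) / (N - 2) ^ 2 *
        (2 * √2 * √(N ^ 2 + 4) - (4 + 2 * N)) :=
      mul_nonneg (div_nonneg (mul_nonneg (by norm_num) (mul_nonneg (by linarith) (by linarith)))
        (sq_nonneg _)) (by linarith)
    nlinarith [mul_pos (sub_pos.2 ha) (sub_pos.2 hb)]

lemma sqrt_sq_add_sq_le_of_add_le {N a b : ℝ} (ha : 1 ≤ a) (hb : 1 ≤ b) (hab : a + b ≤ N + 1) :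
    √(a ^ 2 + b ^ 2) ≤ √(N ^ 2 + 1) := by
  apply Real.sqrt_le_sqrt
  nlinarith [mul_nonneg (sub_nonneg.2 ha) (sub_nonneg.2 hb)]

lemma sqrt_sq_add_sq_lt_of_add_le {N a b : ℝ} (ha : 1 ≤ a) (hb : 1 ≤ b) (haN : a < N)
    (hbN : b < N) (hab : a + b ≤ N + 1) : √(a ^ 2 + b ^ 2) < √(N ^ 2 + 1) := by
  apply Real.sqrt_lt_sqrt (by positivity)
  rcases hab.eq_or_lt with h | h
  · nlinarith [mul_pos (show 0 < a - 1 by linarith) (show 0 < b - 1 by linarith)]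
  · nlinarith [mul_nonneg (sub_nonneg.2 ha) (sub_nonneg.2 hb)]

lemma two_mul_sqrt_two_lt_sqrt {N : ℝ} (hN : 4 ≤ N) : 2 * √2 < √(N ^ 2 + 1) := by
  apply Real.lt_sqrt_of_sq_lt
  rw [mul_pow, Real.sq_sqrt (by norm_num)]
  nlinarith

lemma triangle_weight_lt {N : ℝ} (hN : 4 ≤ N) :
    2 * √(N ^ 2 + 4) + 2 * √2 < 3 * √(N ^ 2 + 1) := by
  have h₁ : √2 < 1.42 := by
    rw [Real.sqrt_lt' (by norm_num)]
    norm_num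
  have h₂ : 4 ≤ √(N ^ 2 + 1) := Real.le_sqrt_of_sq_le (by nlinarith)
  have h₃ : √(N ^ 2 + 4) ≤ √(N ^ 2 + 1) + 0.4 := by
    apply Real.sqrt_le_iff.2 ⟨by positivity, ?_⟩
    have := Real.sq_sqrt (show 0 ≤ N ^ 2 + 1 by positivity)
    nlinarith
  linarith

end Estimates

section Sums

variable {V : Type*} [Fintype V] {G : SimpleGraph V}

/-- The ordered pairs whose underlying unordered pair lies in `s`. -/
noncomputable def orderedPairs (s : Finset (Sym2 V)) : Finset (V × V) :=
  {p | s(p.1, p.2) ∈ s}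

lemma mem_orderedPairs {s : Finset (Sym2 V)} {p : V × V} :
    p ∈ orderedPairs s ↔ s(p.1, p.2) ∈ s := by
  simp [orderedPairs]

lemma SimpleGraph.Walk.IsCycle.sum_fst_orderedPairs {u : V} {c : G.Walk u u} (hc : c.IsCycle)
    (g : V → ℝ) :
    ∑ p ∈ orderedPairs c.edges.toFinset, g p.1 = 2 * ∑ v ∈ c.support.toFinset, g v := by
  have h : ∀ v : V, ∑ w : V, (if s(v, w) ∈ c.edges.toFinset then g v else 0) =
      if v ∈ c.support.toFinset then 2 * g v else 0 := by
    intro v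
    rw [← Finset.sum_filter, Finset.sum_const]
    simp only [List.mem_toFinset]
    split_ifs with hv
    · rw [hc.card_filter_mem_edges hv]
      simp
    · rw [Finset.filter_false_of_mem
        fun w _ hw => hv (c.fst_mem_support_of_mem_edges hw)]
      simp
  rw [orderedPairs, Finset.sum_filter, Fintype.sum_prod_type, Finset.mul_sum]
  simp only [h]
  rw [← Finset.sum_filter]
  exact Finset.sum_congr (by ext; simp) fun _ _ => rfl

lemma sum_snd_orderedPairs (s : Finset (Sym2 V)) (g : V → ℝ) :
    ∑ p ∈ orderedPairs s, g p.2 = ∑ p ∈ orderedPairs s, g p.1 := by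
  refine Finset.sum_equiv (Equiv.prodComm V V) (fun p => ?_) fun p _ => rfl
  simp [mem_orderedPairs, Sym2.eq_swap]

lemma SimpleGraph.Walk.IsCycle.card_orderedPairs {u : V} {c : G.Walk u u} (hc : c.IsCycle) :
    (#(orderedPairs c.edges.toFinset) : ℝ) = 2 * #c.support.toFinset := by
  simpa using hc.sum_fst_orderedPairs fun _ => 1

lemma SimpleGraph.Walk.IsCycle.sum_chord {u : V} {c : G.Walk u u} (hc : c.IsCycle) (A M : ℝ) :
    ∑ p ∈ orderedPairs c.edges.toFinset,
        (A + (((G.degree p.1 : ℝ) - 2) + ((G.degree p.2 : ℝ) - 2)) * M) =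
      2 * #c.support.toFinset * A + 4 * (∑ v ∈ c.support.toFinset, ((G.degree v : ℝ) - 2)) * M := by
  rw [Finset.sum_add_distrib, Finset.sum_const, nsmul_eq_mul, hc.card_orderedPairs,
    ← Finset.sum_mul, Finset.sum_add_distrib, sum_snd_orderedPairs _ fun v => (G.degree v : ℝ) - 2,
    hc.sum_fst_orderedPairs fun v => (G.degree v : ℝ) - 2]
  ring

lemma IsCactus.sum_degree_sub_two_le (hG : IsCactus G) {u : V} {c : G.Walk u u}
    (hc : c.IsCycle) :
    ∑ v ∈ c.support.toFinset, ((G.degree v : ℝ) - 2) ≤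
      Fintype.card V - #c.support.toFinset := by
  have h : ∑ v ∈ c.support.toFinset, ((G.degree v : ℝ) - 2) =
      ((∑ v ∈ c.support.toFinset, (G.degree v - 2) : ℕ) : ℝ) := by
    rw [Nat.cast_sum]
    refine Finset.sum_congr rfl fun v hv => ?_
    rw [Nat.cast_sub (hc.two_le_degree (List.mem_toFinset.1 hv))]
    simp
  have h' := hG.sum_degree_sub_two_add_card_le hc
  rw [h, le_sub_iff_add_le]
  exact_mod_cast h'

variable {N : ℝ}

lemma IsCactus.degree_bounds_of_mem_orderedPairs (hG : IsCactus G)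
    (hcard : (Fintype.card V : ℝ) = N + 1) {u : V} {c : G.Walk u u} (hc : c.IsCycle)
    {p : V × V} (hp : p ∈ orderedPairs c.edges.toFinset) :
    (2 : ℝ) ≤ G.degree p.1 ∧ (2 : ℝ) ≤ G.degree p.2 ∧
      ((G.degree p.1 : ℝ) - 2) + ((G.degree p.2 : ℝ) - 2) ≤ N - 2 := by
  rw [mem_orderedPairs, List.mem_toFinset] at hp
  have h₁ := c.fst_mem_support_of_mem_edges hp
  have h₂ := c.snd_mem_support_of_mem_edges hp
  have hdeg : ∀ v ∈ c.support, (2 : ℝ) ≤ G.degree v := fun v hv => by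
    exact_mod_cast hc.two_le_degree hv
  refine ⟨hdeg _ h₁, hdeg _ h₂, ?_⟩
  rw [← Finset.sum_pair (f := fun v => (G.degree v : ℝ) - 2) (c.adj_of_mem_edges hp).ne]
  have h₃ : (3 : ℝ) ≤ #c.support.toFinset := by exact_mod_cast hc.three_le_card_support
  have h₄ := hG.sum_degree_sub_two_le hc
  refine (Finset.sum_le_sum_of_subset_of_nonneg (t := c.support.toFinset) ?_ ?_).trans
    (h₄.trans (by linarith))
  · intro v hv
    rw [Finset.mem_insert, Finset.mem_singleton] at hv
    rcases hv with rfl | rfl <;> simpa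
  · intro v hv _
    linarith [hdeg v (List.mem_toFinset.1 hv)]

/-- The contribution of a cycle of a cactus to (twice) the Sombor index. -/
lemma IsCactus.sum_orderedPairs_le (hG : IsCactus G) (hN : 2 < N)
    (hcard : (Fintype.card V : ℝ) = N + 1) {u : V} {c : G.Walk u u} (hc : c.IsCycle) :
    ∑ p ∈ orderedPairs c.edges.toFinset, √((G.degree p.1 : ℝ) ^ 2 + (G.degree p.2 : ℝ) ^ 2) ≤
      4 * √(N ^ 2 + 4) + (#c.support.toFinset - 2) * (4 * √2) := by
  have h₁ := two_mul_sqrt_two_lt hN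
  have h₂ := hG.sum_degree_sub_two_le hc
  have h₃ : (3 : ℝ) ≤ #c.support.toFinset := by exact_mod_cast hc.three_le_card_support
  refine (Finset.sum_le_sum fun p hp => ?_).trans ((hc.sum_chord (2 * √2)
    ((√(N ^ 2 + 4) - 2 * √2) / (N - 2))).trans_le ?_)
  · obtain ⟨ha, hb, hab⟩ := hG.degree_bounds_of_mem_orderedPairs hcard hc hp
    exact sqrt_sq_add_sq_le_chord hN ha hb hab
  · have h₄ := mul_le_mul_of_nonneg_right (h₂.trans (show _ ≤ N - 2 by linarith))
      (div_nonneg (sub_nonneg.2 h₁.le) (sub_nonneg.2 hN.le))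
    rw [mul_div_cancel₀ _ (sub_pos.2 hN).ne'] at h₄
    linarith

lemma IsCactus.sum_orderedPairs_lt (hG : IsCactus G) (hN : 2 < N)
    (hcard : (Fintype.card V : ℝ) = N + 1) (hdeg : ∀ v, (G.degree v : ℝ) < N)
    {u : V} {c : G.Walk u u} (hc : c.IsCycle) :
    ∑ p ∈ orderedPairs c.edges.toFinset, √((G.degree p.1 : ℝ) ^ 2 + (G.degree p.2 : ℝ) ^ 2) <
      4 * √(N ^ 2 + 4) + (#c.support.toFinset - 2) * (4 * √2) := by
  have h₁ := two_mul_sqrt_two_lt hN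
  have h₂ := hG.sum_degree_sub_two_le hc
  have h₃ : (3 : ℝ) ≤ #c.support.toFinset := by exact_mod_cast hc.three_le_card_support
  have hle : ∀ p ∈ orderedPairs c.edges.toFinset, _ ≤ _ := fun p hp => by
    obtain ⟨ha, hb, hab⟩ := hG.degree_bounds_of_mem_orderedPairs hcard hc hp
    exact sqrt_sq_add_sq_le_chord hN ha hb hab
  have hM : 0 < (√(N ^ 2 + 4) - 2 * √2) / (N - 2) := div_pos (sub_pos.2 h₁) (sub_pos.2 hN)
  have hMmul : (N - 2) * ((√(N ^ 2 + 4) - 2 * √2) / (N - 2)) = √(N ^ 2 + 4) - 2 * √2 :=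
    mul_div_cancel₀ _ (sub_pos.2 hN).ne'
  by_cases htwo : ∀ v ∈ c.support.toFinset, (G.degree v : ℝ) - 2 = 0
  · refine (Finset.sum_le_sum hle).trans_lt ((hc.sum_chord (2 * √2)
      ((√(N ^ 2 + 4) - 2 * √2) / (N - 2))).trans_lt ?_)
    rw [Finset.sum_eq_zero htwo]
    linarith
  · push Not at htwo
    obtain ⟨v, hv, hv2⟩ := htwo
    rw [List.mem_toFinset] at hv
    have hv2' : (2 : ℝ) < G.degree v := by
      have : (2 : ℝ) ≤ G.degree v := by exact_mod_cast hc.two_le_degree hv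
      exact this.lt_of_ne fun h => hv2 (by linarith)
    obtain ⟨w, hw⟩ : ∃ w, s(v, w) ∈ c.edges := by
      have h := hc.card_filter_mem_edges hv
      obtain ⟨w, hw⟩ := Finset.card_pos.1 (h ▸ two_pos)
      exact ⟨w, (Finset.mem_filter.1 hw).2⟩
    have hp : (v, w) ∈ orderedPairs c.edges.toFinset :=
      mem_orderedPairs.2 (List.mem_toFinset.2 hw)
    obtain ⟨-, hb, hab⟩ := hG.degree_bounds_of_mem_orderedPairs hcard hc hp
    refine (Finset.sum_lt_sum hle ⟨_, hp, sqrt_sq_add_sq_lt_chord hN hv2' (hdeg v) hb hab⟩).trans_le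
      ((hc.sum_chord (2 * √2) ((√(N ^ 2 + 4) - 2 * √2) / (N - 2))).trans_le ?_)
    have h₄ := mul_le_mul_of_nonneg_right (h₂.trans (show _ ≤ N - 2 by linarith)) hM.le
    rw [hMmul] at h₄
    linarith

end Sums

section Bound

variable {V : Type*} [Fintype V] {G : SimpleGraph V} {N : ℝ}

/-- The ordered pairs of adjacent vertices. -/
noncomputable def adjPairs (G : SimpleGraph V) : Finset (V × V) :=
  {p | G.Adj p.1 p.2}

lemma mem_adjPairs {p : V × V} : p ∈ adjPairs G ↔ G.Adj p.1 p.2 := by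
  simp [adjPairs]

lemma two_mul_somborIndex (G : SimpleGraph V) :
    2 * somborIndex G =
      ∑ p ∈ adjPairs G, √((G.degree p.1 : ℝ) ^ 2 + (G.degree p.2 : ℝ) ^ 2) := by
  rw [somborIndex, adjPairs, Finset.sum_filter, Fintype.sum_prod_type]
  ring

lemma card_adjPairs (G : SimpleGraph V) : #(adjPairs G) = 2 * #G.edgeFinset := by
  rw [← G.sum_degrees_eq_twice_card_edges, adjPairs, Finset.card_filter, Fintype.sum_prod_type]
  refine Finset.sum_congr rfl fun v _ => ?_
  rw [← Finset.card_filter, ← G.card_neighborFinset_eq_degree]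
  congr 1
  ext w
  simp

/-- The ordered pairs of adjacent vertices whose edge lies on no cycle. -/
noncomputable def bridgePairs (G : SimpleGraph V) : Finset (V × V) :=
  adjPairs G \ (cycleEdgeSets G).biUnion orderedPairs

lemma mem_bridgePairs {p : V × V} :
    p ∈ bridgePairs G ↔ G.Adj p.1 p.2 ∧ ∀ s ∈ cycleEdgeSets G, s(p.1, p.2) ∉ s := by
  simp [bridgePairs, mem_adjPairs, mem_orderedPairs]

lemma IsCactus.sum_adjPairs (hG : IsCactus G) (g : V × V → ℝ) :
    ∑ p ∈ adjPairs G, g p =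
      ∑ p ∈ bridgePairs G, g p + ∑ s ∈ cycleEdgeSets G, ∑ p ∈ orderedPairs s, g p := by
  rw [← Finset.sum_biUnion, bridgePairs, Finset.sum_sdiff]
  · intro p hp
    rw [Finset.mem_biUnion] at hp
    obtain ⟨s, hs, hp⟩ := hp
    obtain ⟨u, c, -, rfl⟩ := mem_cycleEdgeSets.1 hs
    rw [mem_orderedPairs, List.mem_toFinset] at hp
    exact mem_adjPairs.2 (c.adj_of_mem_edges hp)
  · intro s hs s' hs' hne
    rw [Function.onFun, Finset.disjoint_left]
    intro p hp hp'
    exact hne (hG.eq_of_mem_of_mem hs hs' (mem_orderedPairs.1 hp) (mem_orderedPairs.1 hp'))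

lemma SimpleGraph.Adj.one_le_degree {v w : V} (h : G.Adj v w) : (1 : ℝ) ≤ G.degree v := by
  exact_mod_cast Nat.one_le_iff_ne_zero.2 (G.degree_pos_iff_exists_adj v |>.2 ⟨w, h⟩).ne'

lemma degree_bounds_of_mem_bridgePairs (hcard : (Fintype.card V : ℝ) = N + 1) {p : V × V}
    (hp : p ∈ bridgePairs G) :
    (1 : ℝ) ≤ G.degree p.1 ∧ (1 : ℝ) ≤ G.degree p.2 ∧
      (G.degree p.1 : ℝ) + G.degree p.2 ≤ N + 1 := by
  obtain ⟨hadj, hp⟩ := mem_bridgePairs.1 hp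
  refine ⟨hadj.one_le_degree, hadj.symm.one_le_degree, ?_⟩
  rw [← hcard]
  exact_mod_cast degree_add_degree_le_of_notMem_cycle hadj hp

lemma sum_excess_le_aux (hN : 4 ≤ N) {u : V} {c : G.Walk u u} (hc : c.IsCycle) :
    4 * √(N ^ 2 + 4) + ((#c.support.toFinset : ℝ) - 2) * (4 * √2) -
        #(orderedPairs c.edges.toFinset) * √(N ^ 2 + 1) ≤
      4 * √(N ^ 2 + 4) + 4 * √2 - 6 * √(N ^ 2 + 1) := by
  have h₁ := two_mul_sqrt_two_lt_sqrt hN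
  have h₂ : (3 : ℝ) ≤ #c.support.toFinset := by exact_mod_cast hc.three_le_card_support
  rw [hc.card_orderedPairs]
  nlinarith

lemma IsCactus.sum_excess_le (hG : IsCactus G) (hN : 4 ≤ N)
    (hcard : (Fintype.card V : ℝ) = N + 1) {s : Finset (Sym2 V)} (hs : s ∈ cycleEdgeSets G) :
    ∑ p ∈ orderedPairs s,
        (√((G.degree p.1 : ℝ) ^ 2 + (G.degree p.2 : ℝ) ^ 2) - √(N ^ 2 + 1)) ≤
      4 * √(N ^ 2 + 4) + 4 * √2 - 6 * √(N ^ 2 + 1) := by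
  obtain ⟨u, c, hc, rfl⟩ := mem_cycleEdgeSets.1 hs
  rw [Finset.sum_sub_distrib, Finset.sum_const, nsmul_eq_mul]
  linarith [sum_excess_le_aux hN hc, hG.sum_orderedPairs_le (by linarith) hcard hc]

lemma IsCactus.sum_excess_lt (hG : IsCactus G) (hN : 4 ≤ N)
    (hcard : (Fintype.card V : ℝ) = N + 1) (hdeg : ∀ v, (G.degree v : ℝ) < N)
    {s : Finset (Sym2 V)} (hs : s ∈ cycleEdgeSets G) :
    ∑ p ∈ orderedPairs s,
        (√((G.degree p.1 : ℝ) ^ 2 + (G.degree p.2 : ℝ) ^ 2) - √(N ^ 2 + 1)) <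
      4 * √(N ^ 2 + 4) + 4 * √2 - 6 * √(N ^ 2 + 1) := by
  obtain ⟨u, c, hc, rfl⟩ := mem_cycleEdgeSets.1 hs
  rw [Finset.sum_sub_distrib, Finset.sum_const, nsmul_eq_mul]
  linarith [sum_excess_le_aux hN hc, hG.sum_orderedPairs_lt (by linarith) hcard hdeg hc]

lemma IsCactus.two_mul_somborIndex_sub (hG : IsCactus G) (F : ℝ) :
    2 * somborIndex G - 2 * #G.edgeFinset * F =
      ∑ p ∈ bridgePairs G, (√((G.degree p.1 : ℝ) ^ 2 + (G.degree p.2 : ℝ) ^ 2) - F) +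
        ∑ s ∈ cycleEdgeSets G, ∑ p ∈ orderedPairs s,
          (√((G.degree p.1 : ℝ) ^ 2 + (G.degree p.2 : ℝ) ^ 2) - F) := by
  rw [← hG.sum_adjPairs, Finset.sum_sub_distrib, ← two_mul_somborIndex, Finset.sum_const,
    card_adjPairs]
  simp

lemma IsCactus.le_card_cycleEdgeSets (hG : IsCactus G) {t : ℝ}
    (hcard : (Fintype.card V : ℝ) = N + 1) (hedges : (#G.edgeFinset : ℝ) = N + t) :
    t ≤ #(cycleEdgeSets G) := by
  have h : (#G.edgeFinset + 1 : ℝ) ≤ Fintype.card V + #(cycleEdgeSets G) := by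
    exact_mod_cast hG.1.card_edgeFinset_succ_le
  linarith

lemma bridge_excess_nonpos (hcard : (Fintype.card V : ℝ) = N + 1)
    {p : V × V} (hp : p ∈ bridgePairs G) :
    √((G.degree p.1 : ℝ) ^ 2 + (G.degree p.2 : ℝ) ^ 2) - √(N ^ 2 + 1) ≤ 0 := by
  obtain ⟨ha, hb, hab⟩ := degree_bounds_of_mem_bridgePairs hcard hp
  exact sub_nonpos.2 (sqrt_sq_add_sq_le_of_add_le ha hb hab)

theorem IsCactus.somborIndex_le (hG : IsCactus G) (hN : 4 ≤ N) {t : ℝ}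
    (hcard : (Fintype.card V : ℝ) = N + 1) (hedges : (#G.edgeFinset : ℝ) = N + t) :
    somborIndex G ≤
      (N - 2 * t) * √(N ^ 2 + 1) + 2 * t * √(N ^ 2 + 4) + 2 * √2 * t := by
  have h := hG.two_mul_somborIndex_sub √(N ^ 2 + 1)
  have h₁ := Finset.sum_nonpos fun p hp => bridge_excess_nonpos (G := G) hcard hp (p := p)
  have h₂ := Finset.sum_le_card_nsmul _ _ _ fun s hs => hG.sum_excess_le hN hcard (s := s) hs
  rw [nsmul_eq_mul] at h₂
  have h₃ := mul_le_mul_of_nonneg_right (hG.le_card_cycleEdgeSets hcard hedges)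
    (sub_pos.2 (triangle_weight_lt hN)).le
  rw [hedges] at h
  linarith

theorem IsCactus.somborIndex_lt (hG : IsCactus G) (hN : 4 ≤ N) {t : ℝ} (ht : 0 ≤ t)
    (hcard : (Fintype.card V : ℝ) = N + 1) (hedges : (#G.edgeFinset : ℝ) = N + t)
    (hdeg : ∀ v, (G.degree v : ℝ) < N) :
    somborIndex G <
      (N - 2 * t) * √(N ^ 2 + 1) + 2 * t * √(N ^ 2 + 4) + 2 * √2 * t := by
  have h := hG.two_mul_somborIndex_sub √(N ^ 2 + 1)
  have h₁ := Finset.sum_nonpos fun p hp => bridge_excess_nonpos (G := G) hcard hp (p := p)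
  have h₂ := Finset.sum_le_card_nsmul _ _ _ fun s hs => hG.sum_excess_le hN hcard (s := s) hs
  rw [nsmul_eq_mul] at h₂
  have h₃ := mul_le_mul_of_nonneg_right (hG.le_card_cycleEdgeSets hcard hedges)
    (sub_pos.2 (triangle_weight_lt hN)).le
  rcases (cycleEdgeSets G).eq_empty_or_nonempty with hempty | ⟨s, hs⟩
  · have hne : (adjPairs G).Nonempty := by
      rw [← Finset.card_pos, card_adjPairs]
      have : (0 : ℝ) < #G.edgeFinset := by linarith
      have : 0 < #G.edgeFinset := by exact_mod_cast this
      omega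
    obtain ⟨p, hp⟩ := hne
    have hp' : p ∈ bridgePairs G := mem_bridgePairs.2 ⟨mem_adjPairs.1 hp, by simp [hempty]⟩
    obtain ⟨ha, hb, hab⟩ := degree_bounds_of_mem_bridgePairs hcard hp'
    have h₁' := Finset.sum_neg' (fun p hp => bridge_excess_nonpos (G := G) hcard hp (p := p))
      ⟨p, hp', sub_neg.2 (sqrt_sq_add_sq_lt_of_add_le ha hb (hdeg _) (hdeg _) hab)⟩
    rw [hedges] at h
    linarith
  · have h₂' := Finset.sum_lt_sum (fun s hs => hG.sum_excess_le hN hcard (s := s) hs)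
      ⟨s, hs, hG.sum_excess_lt hN hcard hdeg hs⟩
    rw [Finset.sum_const, nsmul_eq_mul] at h₂'
    rw [hedges] at h
    linarith

end Bound

section Universal

variable {V : Type*} {G : SimpleGraph V} {v₀ : V}

lemma IsCactus.eq_of_adj_of_universal (hG : IsCactus G) (h₀ : ∀ v, v ≠ v₀ → G.Adj v₀ v)
    {v w w' : V} (hv : v ≠ v₀) (hw : w ≠ v₀) (hw' : w' ≠ v₀) (h : G.Adj v w)
    (h' : G.Adj v w') : w = w' :=
  hG.eq_of_adj_of_adj (h₀ v hv) (h₀ w hw) h (h₀ w' hw') h'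

variable [Fintype V]

lemma SimpleGraph.neighborFinset_eq_erase_of_universal (h₀ : ∀ v, v ≠ v₀ → G.Adj v₀ v) :
    G.neighborFinset v₀ = Finset.univ.erase v₀ := by
  ext v
  simp only [mem_neighborFinset, Finset.mem_erase, Finset.mem_univ, and_true]
  exact ⟨fun h => h.ne', h₀ v⟩

lemma SimpleGraph.universal_of_degree_eq (h : G.degree v₀ + 1 = Fintype.card V) (v : V)
    (hv : v ≠ v₀) : G.Adj v₀ v := by
  have hsub : G.neighborFinset v₀ ⊆ Finset.univ.erase v₀ := fun w hw => by
    rw [mem_neighborFinset] at hw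
    simpa using hw.ne'
  have heq := Finset.eq_of_subset_of_card_le hsub (by
    rw [Finset.card_erase_of_mem (Finset.mem_univ _), G.card_neighborFinset_eq_degree,
      Finset.card_univ]
    omega)
  rw [← mem_neighborFinset, heq]
  simpa using hv

lemma SimpleGraph.card_erase_neighborFinset (h₀ : ∀ v, v ≠ v₀ → G.Adj v₀ v) {v : V}
    (hv : v ≠ v₀) : #((G.neighborFinset v).erase v₀) + 1 = G.degree v := by
  rw [← G.card_neighborFinset_eq_degree, Finset.card_erase_add_one]
  exact (mem_neighborFinset _ _ _).2 (h₀ v hv).symm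

lemma IsCactus.card_erase_neighborFinset_le_one (hG : IsCactus G)
    (h₀ : ∀ v, v ≠ v₀ → G.Adj v₀ v) {v : V} (hv : v ≠ v₀) :
    #((G.neighborFinset v).erase v₀) ≤ 1 := by
  rw [Finset.card_le_one]
  intro w hw w' hw'
  rw [Finset.mem_erase, mem_neighborFinset] at hw hw'
  exact hG.eq_of_adj_of_universal h₀ hv hw.1 hw'.1 hw.2 hw'.2

lemma IsCactus.degree_eq_two_of_adj (hG : IsCactus G) (h₀ : ∀ v, v ≠ v₀ → G.Adj v₀ v)
    {v w : V} (hv : v ≠ v₀) (hw : w ≠ v₀) (h : G.Adj v w) : G.degree v = 2 := by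
  have h₁ := hG.card_erase_neighborFinset_le_one h₀ hv
  have h₂ := G.card_erase_neighborFinset h₀ hv
  have h₃ : 0 < #((G.neighborFinset v).erase v₀) :=
    Finset.card_pos.2 ⟨w, Finset.mem_erase.2 ⟨hw, (mem_neighborFinset _ _ _).2 h⟩⟩
  omega

lemma sqrt_two_sq_add_two_sq : √((2 : ℝ) ^ 2 + 2 ^ 2) = 2 * √2 := by
  rw [show (2 : ℝ) ^ 2 + 2 ^ 2 = 2 ^ 2 * 2 by norm_num, Real.sqrt_mul (by norm_num),
    Real.sqrt_sq (by norm_num)]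

/-- A cactus with a vertex adjacent to all others attains the bound. -/
theorem IsCactus.somborIndex_eq_of_universal (hG : IsCactus G)
    (h₀ : ∀ v, v ≠ v₀ → G.Adj v₀ v) {N t : ℝ}
    (hcard : (Fintype.card V : ℝ) = N + 1) (hedges : (#G.edgeFinset : ℝ) = N + t) :
    somborIndex G =
      (N - 2 * t) * √(N ^ 2 + 1) + 2 * t * √(N ^ 2 + 4) + 2 * √2 * t := by
  have hcard' : (#(Finset.univ.erase v₀) : ℝ) = N := by
    rw [Finset.card_erase_of_mem (Finset.mem_univ _), Finset.card_univ,
      Nat.cast_sub (Fintype.card_pos_iff.2 ⟨v₀⟩), hcard]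
    simp
  have hdeg₀ : (G.degree v₀ : ℝ) = N := by
    rw [← G.card_neighborFinset_eq_degree, G.neighborFinset_eq_erase_of_universal h₀, hcard']
  have hcenter : ∀ v ∈ Finset.univ.erase v₀, √(N ^ 2 + (G.degree v : ℝ) ^ 2) =
      √(N ^ 2 + 1) + ((G.degree v : ℝ) - 1) * (√(N ^ 2 + 4) - √(N ^ 2 + 1)) := by
    intro v hv
    have hv := Finset.ne_of_mem_erase hv
    have h₁ := hG.card_erase_neighborFinset_le_one h₀ hv
    have h₂ := G.card_erase_neighborFinset h₀ hv
    have h₃ : G.degree v = 1 ∨ G.degree v = 2 := by omega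
    rcases h₃ with h₃ | h₃ <;> rw [h₃]
    · simp
    · norm_num
  have hrow : ∀ v, ∑ w, (if G.Adj v w then √((G.degree v : ℝ) ^ 2 + (G.degree w : ℝ) ^ 2) else 0) =
      ∑ w ∈ G.neighborFinset v, √((G.degree v : ℝ) ^ 2 + (G.degree w : ℝ) ^ 2) := by
    intro v
    rw [← Finset.sum_filter]
    exact Finset.sum_congr (by ext; simp) fun _ _ => rfl
  have hleaf : ∀ v ∈ Finset.univ.erase v₀,
      ∑ w ∈ G.neighborFinset v, √((G.degree v : ℝ) ^ 2 + (G.degree w : ℝ) ^ 2) =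
        √(N ^ 2 + 1) + ((G.degree v : ℝ) - 1) * (√(N ^ 2 + 4) - √(N ^ 2 + 1) + 2 * √2) := by
    intro v hv
    have hv' := Finset.ne_of_mem_erase hv
    rw [← Finset.add_sum_erase _ _ ((mem_neighborFinset _ _ _).2 (h₀ v hv').symm), hdeg₀,
      add_comm ((G.degree v : ℝ) ^ 2), hcenter v hv]
    have hsum : ∑ w ∈ (G.neighborFinset v).erase v₀,
        √((G.degree v : ℝ) ^ 2 + (G.degree w : ℝ) ^ 2) = ((G.degree v : ℝ) - 1) * (2 * √2) := by
      have hcast : (#((G.neighborFinset v).erase v₀) : ℝ) = (G.degree v : ℝ) - 1 := by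
        rw [← G.card_erase_neighborFinset h₀ hv']
        simp
      rw [← hcast, ← nsmul_eq_mul]
      refine Finset.sum_eq_card_nsmul fun w hw => ?_
      rw [Finset.mem_erase, mem_neighborFinset] at hw
      rw [hG.degree_eq_two_of_adj h₀ hv' hw.1 hw.2,
        hG.degree_eq_two_of_adj h₀ hw.1 hv' hw.2.symm, Nat.cast_ofNat, sqrt_two_sq_add_two_sq]
    rw [hsum]
    ring
  have hdegsum : ∑ v ∈ Finset.univ.erase v₀, ((G.degree v : ℝ) - 1) = 2 * t := by
    have h : (∑ v, (G.degree v : ℝ)) = 2 * #G.edgeFinset := by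
      exact_mod_cast G.sum_degrees_eq_twice_card_edges
    rw [← Finset.add_sum_erase _ _ (Finset.mem_univ v₀), hdeg₀, hedges] at h
    rw [Finset.sum_sub_distrib, Finset.sum_const, nsmul_eq_mul, hcard']
    linarith
  rw [somborIndex, Finset.sum_congr rfl fun v _ => hrow v,
    ← Finset.add_sum_erase _ _ (Finset.mem_univ v₀), Finset.sum_congr rfl hleaf,
    G.neighborFinset_eq_erase_of_universal h₀, hdeg₀, Finset.sum_congr rfl hcenter]
  simp only [Finset.sum_add_distrib, Finset.sum_const, nsmul_eq_mul, hcard', ← Finset.sum_mul,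
    hdegsum]
  ring

end Universal

section Isomorphism

lemma Hgraph_adj {n t : ℕ} {i j : Fin n} : (Hgraph n t).Adj i j ↔ i ≠ j ∧
    ((i.val = 0 ∨ ∃ k, k < t ∧ i.val = 2 * k + 1 ∧ j.val = 2 * k + 2) ∨
      (j.val = 0 ∨ ∃ k, k < t ∧ j.val = 2 * k + 1 ∧ i.val = 2 * k + 2)) :=
  fromRel_adj _ _ _

lemma exists_universal_of_iso {V : Type*} {G : SimpleGraph V} {n t : ℕ} (hn : 0 < n)
    (e : G ≃g Hgraph n t) : ∃ v₀, ∀ v, v ≠ v₀ → G.Adj v₀ v := by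
  refine ⟨e.symm ⟨0, hn⟩, fun v hv => ?_⟩
  rw [← e.map_adj_iff, e.apply_symm_apply, Hgraph_adj]
  exact ⟨fun h => hv (by rw [h, e.symm_apply_apply]), Or.inl (Or.inl rfl)⟩

variable {V : Type*} [Fintype V] {G : SimpleGraph V} {v₀ : V}

lemma SimpleGraph.card_edgeFinset_filter_notMem (h₀ : ∀ v, v ≠ v₀ → G.Adj v₀ v) :
    #(G.edgeFinset.filter fun e => v₀ ∉ e) + Fintype.card V = #G.edgeFinset + 1 := by
  have h₁ := Finset.card_filter_add_card_filter_not (s := G.edgeFinset) fun e => v₀ ∈ e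
  have h₂ : #(G.edgeFinset.filter fun e => v₀ ∈ e) = Fintype.card V - 1 := by
    rw [← G.incidenceFinset_eq_filter, G.card_incidenceFinset_eq_degree,
      ← G.card_neighborFinset_eq_degree, G.neighborFinset_eq_erase_of_universal h₀,
      Finset.card_erase_of_mem (Finset.mem_univ _), Finset.card_univ]
  have h₃ := Fintype.card_pos_iff.2 ⟨v₀⟩
  omega

/-- Enumeration of the edges that avoid a vertex adjacent to all others. -/
lemma SimpleGraph.exists_enum_edges_notMem (h₀ : ∀ v, v ≠ v₀ → G.Adj v₀ v) {t : ℕ}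
    (hedges : #G.edgeFinset + 1 = Fintype.card V + t) :
    ∃ a b : ℕ → V, (∀ k < t, G.Adj (a k) (b k) ∧ a k ≠ v₀ ∧ b k ≠ v₀) ∧
      (∀ k < t, ∀ l < t, s(a k, b k) = s(a l, b l) → k = l) ∧
      ∀ v w, G.Adj v w → v ≠ v₀ → w ≠ v₀ → ∃ k < t, s(v, w) = s(a k, b k) := by
  have hcard : #(G.edgeFinset.filter fun e => v₀ ∉ e) = t := by
    have := G.card_edgeFinset_filter_notMem h₀
    omega
  let φ := Finset.equivFinOfCardEq hcard
  have hmk : ∀ k : ℕ, ∃ p : V × V, ∀ hk : k < t, s(p.1, p.2) = (φ.symm ⟨k, hk⟩ : Sym2 V) := by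
    intro k
    by_cases hk : k < t
    · obtain ⟨p, hp⟩ := Sym2.mk_surjective (φ.symm ⟨k, hk⟩ : Sym2 V)
      exact ⟨p, fun _ => hp⟩
    · exact ⟨(v₀, v₀), fun h => absurd h hk⟩
  choose p hp using hmk
  refine ⟨fun k => (p k).1, fun k => (p k).2, fun k hk => ?_, fun k hk l hl h => ?_,
    fun v w hvw hv hw => ?_⟩
  · have h := (φ.symm ⟨k, hk⟩).2
    rw [← hp k hk, Finset.mem_filter, mem_edgeFinset, mem_edgeSet, Sym2.mem_iff, not_or] at h
    exact ⟨h.1, Ne.symm h.2.1, Ne.symm h.2.2⟩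
  · rw [hp k hk, hp l hl] at h
    simpa using φ.symm.injective (Subtype.ext h)
  · have hmem : s(v, w) ∈ G.edgeFinset.filter fun e => v₀ ∉ e := by
      rw [Finset.mem_filter, mem_edgeFinset, mem_edgeSet, Sym2.mem_iff, not_or]
      exact ⟨hvw, Ne.symm hv, Ne.symm hw⟩
    refine ⟨φ ⟨_, hmem⟩, (φ ⟨_, hmem⟩).2, ?_⟩
    rw [hp _ (φ ⟨_, hmem⟩).2]
    simp

lemma IsCactus.nonempty_iso_of_universal (hG : IsCactus G) (h₀ : ∀ v, v ≠ v₀ → G.Adj v₀ v)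
    {n t : ℕ} (htn : 2 * t + 1 ≤ n) (hcard : Fintype.card V = n)
    (hedges : #G.edgeFinset + 1 = n + t) : Nonempty (G ≃g Hgraph n t) := by
  subst hcard
  obtain ⟨a, b, hab, hinj, hsurj⟩ := G.exists_enum_edges_notMem h₀ hedges
  have haa : ∀ k < t, ∀ l < t, a k = a l → k = l := fun k hk l hl h => by
    refine hinj k hk l hl ?_
    have hb := hG.eq_of_adj_of_universal h₀ (hab k hk).2.1 (hab k hk).2.2 (hab l hl).2.2
      (hab k hk).1 (h ▸ (hab l hl).1)
    rw [h, hb]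
  have hbb : ∀ k < t, ∀ l < t, b k = b l → k = l := fun k hk l hl h => by
    refine hinj k hk l hl ?_
    have ha := hG.eq_of_adj_of_universal h₀ (hab k hk).2.2 (hab k hk).2.1 (hab l hl).2.1
      (hab k hk).1.symm (h ▸ (hab l hl).1.symm)
    rw [h, ha]
  have hne : ∀ k < t, ∀ l < t, a k ≠ b l := fun k hk l hl h => by
    have hb := hG.eq_of_adj_of_universal h₀ (hab k hk).2.1 (hab k hk).2.2 (hab l hl).2.1
      (hab k hk).1 (h ▸ (hab l hl).1.symm)
    have hkl := hinj k hk l hl (by rw [h, hb, Sym2.eq_swap])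
    subst hkl
    exact (hab k hk).1.ne h
  let f : Fin (Fintype.card V) → V := fun i =>
    if i.val = 0 then v₀ else if i.val % 2 = 1 then a (i.val / 2) else b (i.val / 2 - 1)
  let S : Finset (Fin (Fintype.card V)) := {i | i.val ≤ 2 * t}
  have hfS : Set.InjOn f S := by
    intro i hi j hj hij
    simp only [S, Finset.coe_filter, Finset.mem_univ, true_and, Set.mem_ofPred_eq] at hi hj
    simp only [f] at hij
    apply Fin.ext
    split_ifs at hij with h₁ h₂ h₃ h₄ h₅ h₆ h₇ h₈
    · omega
    · exact absurd hij.symm (hab _ (by omega)).2.1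
    · exact absurd hij.symm (hab _ (by omega)).2.2
    · exact absurd hij (hab _ (by omega)).2.1
    · have := haa _ (by omega) _ (by omega) hij
      omega
    · exact absurd hij (hne _ (by omega) _ (by omega))
    · exact absurd hij (hab _ (by omega)).2.2
    · exact absurd hij.symm (hne _ (by omega) _ (by omega))
    · have := hbb _ (by omega) _ (by omega) hij
      omega
  obtain ⟨φ', hφ'⟩ := Finset.exists_equiv_extend_of_card_eq (t := (Finset.univ : Finset V))
    (by simp) (Finset.subset_univ (S.image f)) hfS
  let φ : Fin (Fintype.card V) ≃ V := φ'.trans (Equiv.subtypeUnivEquiv Finset.mem_univ)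
  have hφ : ∀ i : Fin (Fintype.card V), i.val ≤ 2 * t → φ i = f i := fun i hi =>
    hφ' i (by simpa [S] using hi)
  have hzero : ∀ i : Fin (Fintype.card V), i.val = 0 → φ i = v₀ := fun i hi => by
    rw [hφ i (by omega)]
    simp [f, hi]
  have hodd : ∀ (i : Fin (Fintype.card V)) (k : ℕ), k < t → i.val = 2 * k + 1 → φ i = a k :=
    fun i k hk hi => by
      rw [hφ i (by omega)]
      simp only [f]
      rw [if_neg (by omega), if_pos (by omega)]
      congr 1
      omega
  have heven : ∀ (i : Fin (Fintype.card V)) (k : ℕ), k < t → i.val = 2 * k + 2 → φ i = b k :=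
    fun i k hk hi => by
      rw [hφ i (by omega)]
      simp only [f]
      rw [if_neg (by omega), if_neg (by omega)]
      congr 1
      omega
  have hzero' : ∀ i : Fin (Fintype.card V), φ i = v₀ → i.val = 0 := fun i hi => by
    have h := φ.injective (hi.trans (hzero ⟨0, by omega⟩ rfl).symm)
    rw [h]
  have hodd' : ∀ (i : Fin (Fintype.card V)) (k : ℕ), k < t → φ i = a k → i.val = 2 * k + 1 :=
    fun i k hk hi => by
      have h := φ.injective (hi.trans (hodd ⟨2 * k + 1, by omega⟩ k hk rfl).symm)
      rw [h]
  have heven' : ∀ (i : Fin (Fintype.card V)) (k : ℕ), k < t → φ i = b k → i.val = 2 * k + 2 :=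
    fun i k hk hi => by
      have h := φ.injective (hi.trans (heven ⟨2 * k + 2, by omega⟩ k hk rfl).symm)
      rw [h]
  have hadj : ∀ i j : Fin (Fintype.card V), i ≠ j →
      (i.val = 0 ∨ ∃ k, k < t ∧ i.val = 2 * k + 1 ∧ j.val = 2 * k + 2) → G.Adj (φ i) (φ j) := by
    rintro i j hij (hi | ⟨k, hk, hi, hj⟩)
    · rw [hzero i hi]
      exact h₀ _ fun h => hij (Fin.ext (by rw [hi, hzero' j h]))
    · rw [hodd i k hk hi, heven j k hk hj]
      exact (hab k hk).1
  refine ⟨RelIso.symm ⟨φ, fun {i j} => ?_⟩⟩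
  rw [Hgraph_adj]
  constructor
  · intro h
    refine ⟨fun hij => h.ne (congrArg φ hij), ?_⟩
    by_cases hi : φ i = v₀
    · exact Or.inl (Or.inl (hzero' i hi))
    by_cases hj : φ j = v₀
    · exact Or.inr (Or.inl (hzero' j hj))
    obtain ⟨k, hk, he⟩ := hsurj _ _ h hi hj
    rcases Sym2.eq_iff.1 he with ⟨hi, hj⟩ | ⟨hi, hj⟩
    · exact Or.inl (Or.inr ⟨k, hk, hodd' i k hk hi, heven' j k hk hj⟩)
    · exact Or.inr (Or.inr ⟨k, hk, hodd' j k hk hj, heven' i k hk hi⟩)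
  · rintro ⟨hij, h | h⟩
    · exact hadj i j hij h
    · exact (hadj j i hij.symm h).symm

end Isomorphism

theorem cactus_sombor_le {V : Type*} [Fintype V] (G : SimpleGraph V) (n t : ℕ)
    (hn : 5 ≤ n) (htn : 2 * t + 1 ≤ n) (hcard : Fintype.card V = n)
    (hcactus : IsCactus G) (hcycles : G.edgeFinset.card = n - 1 + t) :
    somborIndex G ≤ ((n : ℝ) - 2 * t - 1) * Real.sqrt (((n : ℝ) - 1)^2 + 1) +
        2 * t * Real.sqrt (((n : ℝ) - 1)^2 + 4) + 2 * Real.sqrt 2 * t ∧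
    (somborIndex G = ((n : ℝ) - 2 * t - 1) * Real.sqrt (((n : ℝ) - 1)^2 + 1) +
        2 * t * Real.sqrt (((n : ℝ) - 1)^2 + 4) + 2 * Real.sqrt 2 * t ↔
      Nonempty (G ≃g Hgraph n t)) := by
  subst hcard
  have hN : (4 : ℝ) ≤ (Fintype.card V : ℝ) - 1 := by
    have : (5 : ℝ) ≤ Fintype.card V := by exact_mod_cast hn
    linarith
  have hcard : (Fintype.card V : ℝ) = ((Fintype.card V : ℝ) - 1) + 1 := by ring
  have hedges' : #G.edgeFinset + 1 = Fintype.card V + t := by omega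
  have hedges : (#G.edgeFinset : ℝ) = ((Fintype.card V : ℝ) - 1) + t := by
    have : (#G.edgeFinset + 1 : ℝ) = Fintype.card V + t := by exact_mod_cast hedges'
    linarith
  rw [sub_right_comm]
  refine ⟨hcactus.somborIndex_le hN hcard hedges, fun heq => ?_, fun ⟨e⟩ => ?_⟩
  · by_cases hdeg : ∀ v, (G.degree v : ℝ) < (Fintype.card V : ℝ) - 1
    · exact absurd heq (hcactus.somborIndex_lt hN t.cast_nonneg hcard hedges hdeg).ne
    · push Not at hdeg
      obtain ⟨v₀, hv₀⟩ := hdeg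
      have hlt := G.degree_lt_card_verts v₀
      have hle : (Fintype.card V : ℝ) ≤ G.degree v₀ + 1 := by linarith
      have hle' : Fintype.card V ≤ G.degree v₀ + 1 := by exact_mod_cast hle
      exact hcactus.nonempty_iso_of_universal
        (G.universal_of_degree_eq (by omega : G.degree v₀ + 1 = Fintype.card V)) htn rfl hedges'
  · obtain ⟨v₀, h₀⟩ := exists_universal_of_iso (by omega) e
    exact hcactus.somborIndex_eq_of_universal h₀ hcard hedges
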